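/- Let φ be an Orlicz N-function. For any f ∈ Λ_{φ,w}, setting f_n = f·χ_{{t : 1/n ≤ |f(t)| ≤ n}}, one has lim_{n→∞} ‖f − f_n‖ = lim_{n→∞} ‖f − f_n‖⁰ = θ(f). -/

import Mathlib

open MeasureTheory Set Filter Topology ENNReal

noncomputable section

namespace OL

/-- The interval `I = [0, γ)` inside `ℝ`, for `γ : ℝ≥0∞`. -/
def II (γ : ℝ≥0∞) : Set ℝ := {t : ℝ | 0 ≤ t ∧ (ENNReal.ofReal t) < γ}

/-- Distribution function of `f` on `I = [0, γ)`. -/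
def df (γ : ℝ≥0∞) (f : ℝ → ℝ) (l : ℝ) : ℝ≥0∞ := volume {s | s ∈ II γ ∧ l < |f s|}

/-- Decreasing rearrangement of `f` on `I = [0, γ)`. -/
def rear (γ : ℝ≥0∞) (f : ℝ → ℝ) (t : ℝ) : ℝ :=
  sInf {l : ℝ | 0 < l ∧ df γ f l ≤ ENNReal.ofReal t}

/-- The modular `ρ_{φ,w}(f) = ∫_I φ(f^*) w`. -/
def rho (γ : ℝ≥0∞) (φ w f : ℝ → ℝ) : ℝ≥0∞ :=
  ∫⁻ t in II γ, ENNReal.ofReal (φ (rear γ f t) * w t)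

/-- Membership in the Orlicz–Lorentz space `Λ_{φ,w}`. -/
def MemL (γ : ℝ≥0∞) (φ w f : ℝ → ℝ) : Prop :=
  Measurable f ∧ ∃ l : ℝ, 0 < l ∧ rho γ φ w (fun t => l * f t) < ⊤

/-- Membership in the order-continuous part `(Λ_{φ,w})_a`. -/
def MemLa (γ : ℝ≥0∞) (φ w f : ℝ → ℝ) : Prop :=
  Measurable f ∧ ∀ l : ℝ, 0 < l → rho γ φ w (fun t => l * f t) < ⊤

/-- The Luxemburg norm on `Λ_{φ,w}`. -/
def lux (γ : ℝ≥0∞) (φ w f : ℝ → ℝ) : ℝ :=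
  sInf {ε : ℝ | 0 < ε ∧ rho γ φ w (fun t => f t / ε) ≤ 1}

/-- The complementary Orlicz function `φ_*(v) = sup{uv - φ(u) : u ≥ 0}`. -/
def conj (φ : ℝ → ℝ) (v : ℝ) : ℝ := sSup {x : ℝ | ∃ u : ℝ, 0 ≤ u ∧ x = u * v - φ u}

/-- The Orlicz norm on `Λ_{φ,w}` (with values in `ℝ≥0∞`):
`‖f‖⁰ = sup{∫_I f^* g^* w : ρ_{φ_*,w}(g) ≤ 1}`. -/
def orl (γ : ℝ≥0∞) (φ w f : ℝ → ℝ) : ℝ≥0∞ :=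
  ⨆ g ∈ {g : ℝ → ℝ | Measurable g ∧ rho γ (conj φ) w g ≤ 1},
    ∫⁻ t in II γ, ENNReal.ofReal (rear γ f t * rear γ g t * w t)

/-- `θ(f) = inf{λ > 0 : ρ_{φ,w}(f/λ) < ∞}`. -/
def theta (γ : ℝ≥0∞) (φ w f : ℝ → ℝ) : ℝ :=
  sInf {l : ℝ | 0 < l ∧ rho γ φ w (fun t => f t / l) < ⊤}

/-- Orlicz function. -/
def IsOrlicz (φ : ℝ → ℝ) : Prop :=
  ConvexOn ℝ (Ici 0) φ ∧ φ 0 = 0 ∧ ∀ t : ℝ, 0 < t → 0 < φ t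

/-- Orlicz `N`-function. -/
def IsN (φ : ℝ → ℝ) : Prop :=
  IsOrlicz φ ∧ Tendsto (fun t => φ t / t) (𝓝[>] (0:ℝ)) (𝓝 0) ∧
    Tendsto (fun t => φ t / t) atTop atTop

/-- `p` is the right derivative of `φ` on `[0,∞)`. -/
def IsRightDeriv (φ p : ℝ → ℝ) : Prop :=
  ∀ u : ℝ, 0 ≤ u → HasDerivWithinAt φ (p u) (Ici u) u

/-- An admissible (decreasing, positive, locally integrable) weight on `[0, γ)`,
with `W(∞) = ∞` when `γ = ∞`. -/
def IsWeight (γ : ℝ≥0∞) (w : ℝ → ℝ) : Prop :=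
  Measurable w ∧ (∀ t ∈ II γ, 0 < w t) ∧
  (∀ s ∈ II γ, ∀ t ∈ II γ, s ≤ t → w t ≤ w s) ∧
  (∀ t ∈ II γ, IntegrableOn w (Icc 0 t) volume) ∧
  (γ = ⊤ → (∫⁻ t in II γ, ENNReal.ofReal (w t)) = ⊤)

/-- `k^*(f)`. -/
def kstar (γ : ℝ≥0∞) (φ w p f : ℝ → ℝ) : ℝ :=
  sInf {k : ℝ | 0 < k ∧ 1 ≤ rho γ (conj φ) w (fun t => p (k * |f t|))}

/-- `k^{**}(f)`. -/
def kstarstar (γ : ℝ≥0∞) (φ w p f : ℝ → ℝ) : ℝ :=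
  sSup {k : ℝ | 0 < k ∧ rho γ (conj φ) w (fun t => p (k * |f t|)) ≤ 1}

/-- Linearity of a functional on the subspace `Λ_{φ,w}`. -/
def IsLin (γ : ℝ≥0∞) (φ w : ℝ → ℝ) (S : (ℝ → ℝ) → ℝ) : Prop :=
  (∀ f g : ℝ → ℝ, MemL γ φ w f → MemL γ φ w g → S (f + g) = S f + S g) ∧
  (∀ (c : ℝ) (f : ℝ → ℝ), MemL γ φ w f → S (c • f) = c * S f)

/-- Boundedness with respect to the Luxemburg norm. -/
def BddLux (γ : ℝ≥0∞) (φ w : ℝ → ℝ) (S : (ℝ → ℝ) → ℝ) : Prop :=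
  ∃ C : ℝ, ∀ f : ℝ → ℝ, MemL γ φ w f → |S f| ≤ C * lux γ φ w f

/-- Boundedness with respect to the Orlicz norm. -/
def BddOrl (γ : ℝ≥0∞) (φ w : ℝ → ℝ) (S : (ℝ → ℝ) → ℝ) : Prop :=
  ∃ C : ℝ, 0 ≤ C ∧ ∀ f : ℝ → ℝ, MemL γ φ w f →
    ENNReal.ofReal |S f| ≤ ENNReal.ofReal C * orl γ φ w f

/-- A singular functional: bounded, linear, vanishing on the order-continuous part. -/
def IsSingular (γ : ℝ≥0∞) (φ w : ℝ → ℝ) (S : (ℝ → ℝ) → ℝ) : Prop :=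
  IsLin γ φ w S ∧ BddLux γ φ w S ∧ ∀ f : ℝ → ℝ, MemLa γ φ w f → S f = 0

/-- Operator norm with respect to the Luxemburg norm. -/
def opLux (γ : ℝ≥0∞) (φ w : ℝ → ℝ) (S : (ℝ → ℝ) → ℝ) : ℝ :=
  sSup {r : ℝ | ∃ f : ℝ → ℝ, MemL γ φ w f ∧ lux γ φ w f ≤ 1 ∧ r = S f}

/-- Operator norm with respect to the Orlicz norm. -/
def opOrl (γ : ℝ≥0∞) (φ w : ℝ → ℝ) (S : (ℝ → ℝ) → ℝ) : ℝ :=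
  sSup {r : ℝ | ∃ f : ℝ → ℝ, MemL γ φ w f ∧ orl γ φ w f ≤ 1 ∧ r = S f}

/-- `v ≺ w` : `∫₀ᵗ v^* ≤ ∫₀ᵗ w` for all `t ∈ I`, with `v` nonnegative and measurable. -/
def Prec (γ : ℝ≥0∞) (w v : ℝ → ℝ) : Prop :=
  Measurable v ∧ (∀ t : ℝ, 0 ≤ v t) ∧
  ∀ t ∈ II γ, (∫⁻ s in Icc (0:ℝ) t, ENNReal.ofReal (rear γ v s)) ≤
    ∫⁻ s in Icc (0:ℝ) t, ENNReal.ofReal (w s)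

/-- The modular `P_{ψ,w}(h) = inf{∫_I ψ(|h|/v) v : v ≥ 0, v ≺ w}`. -/
def P (γ : ℝ≥0∞) (ψ w h : ℝ → ℝ) : ℝ≥0∞ :=
  ⨅ v ∈ {v : ℝ → ℝ | Prec γ w v}, ∫⁻ t in II γ, ENNReal.ofReal (ψ (|h t| / v t) * v t)

/-- Luxemburg norm of the space `M_{ψ,w}` (real-valued). -/
def Mlux (γ : ℝ≥0∞) (ψ w h : ℝ → ℝ) : ℝ :=
  sInf {ε : ℝ | 0 < ε ∧ P γ ψ w (fun t => h t / ε) ≤ 1}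

/-- Luxemburg norm of the space `M_{ψ,w}` (`ℝ≥0∞`-valued; `∞` when `h ∉ M_{ψ,w}`). -/
def MluxE (γ : ℝ≥0∞) (ψ w h : ℝ → ℝ) : ℝ≥0∞ :=
  sInf {e : ℝ≥0∞ | ∃ ε : ℝ, 0 < ε ∧ e = ENNReal.ofReal ε ∧ P γ ψ w (fun t => h t / ε) ≤ 1}

/-- Orlicz norm of the space `M_{ψ,w}`: `inf_{k>0} (1/k)(1 + P_{ψ,w}(kh))`. -/
def Morl (γ : ℝ≥0∞) (ψ w h : ℝ → ℝ) : ℝ≥0∞ :=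
  ⨅ k ∈ Ioi (0:ℝ), (ENNReal.ofReal k)⁻¹ * (1 + P γ ψ w (fun t => k * h t))

/-- The appropriate `Δ₂` condition: `Δ₂` if `γ = ∞`, `Δ₂^∞` if `γ < ∞`. -/
def appDelta2 (γ : ℝ≥0∞) (φ : ℝ → ℝ) : Prop :=
  (γ = ⊤ → ∃ K : ℝ, 0 < K ∧ ∀ u : ℝ, 0 ≤ u → φ (2 * u) ≤ K * φ u) ∧
  (γ ≠ ⊤ → ∃ K u₀ : ℝ, 0 < K ∧ 0 ≤ u₀ ∧ ∀ u : ℝ, u₀ ≤ u → φ (2 * u) ≤ K * φ u)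

/-- The interval without its left end point. -/
def JJ (γ : ℝ≥0∞) : Set ℝ := II γ ∩ Ioi 0

lemma meas_II (γ : ℝ≥0∞) : MeasurableSet (II γ) := by
  have : II γ = Ici 0 ∩ ENNReal.ofReal ⁻¹' (Iio γ) := by
    ext t; simp [II]
  rw [this]
  exact measurableSet_Ici.inter (ENNReal.measurable_ofReal measurableSet_Iio)

lemma meas_JJ (γ : ℝ≥0∞) : MeasurableSet (JJ γ) := (meas_II γ).inter measurableSet_Ioi

lemma lint_JJ (γ : ℝ≥0∞) (F : ℝ → ℝ≥0∞) : ∫⁻ t in II γ, F t = ∫⁻ t in JJ γ, F t := by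
  apply setLIntegral_congr
  have h : ∀ᵐ t : ℝ ∂volume, t ≠ 0 := by
    simp [ae_iff]
  filter_upwards [h] with t ht
  apply propext
  constructor
  · intro h1
    exact ⟨h1, lt_of_le_of_ne h1.1 (Ne.symm ht)⟩
  · intro h1
    exact h1.1

lemma II_eq_Ico {γ : ℝ≥0∞} (h : γ ≠ ⊤) : II γ = Ico 0 γ.toReal := by
  ext t
  simp only [II, mem_ofPred_eq, mem_Ico]
  constructor
  · rintro ⟨h1, h2⟩
    exact ⟨h1, (ENNReal.ofReal_lt_iff_lt_toReal h1 h).1 h2⟩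
  · rintro ⟨h1, h2⟩
    exact ⟨h1, (ENNReal.ofReal_lt_iff_lt_toReal h1 h).2 h2⟩

lemma vol_II {γ : ℝ≥0∞} (h : γ ≠ ⊤) : volume (II γ) < ⊤ := by
  rw [II_eq_Ico h]; simp

/-- `f` has a finite distribution function somewhere. -/
def Good (γ : ℝ≥0∞) (f : ℝ → ℝ) : Prop := ∃ l : ℝ, 0 < l ∧ df γ f l < ⊤

lemma df_anti (γ : ℝ≥0∞) (f : ℝ → ℝ) : Antitone (df γ f) := by
  intro a b hab
  apply measure_mono
  rintro s ⟨h1, h2⟩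
  exact ⟨h1, lt_of_le_of_lt hab h2⟩

lemma df_mono (γ : ℝ≥0∞) {h f : ℝ → ℝ} (hh : ∀ t, |h t| ≤ |f t|) (l : ℝ) :
    df γ h l ≤ df γ f l := by
  apply measure_mono
  rintro s ⟨h1, h2⟩
  exact ⟨h1, lt_of_lt_of_le h2 (hh s)⟩

lemma df_tendsto {γ : ℝ≥0∞} {f : ℝ → ℝ} (hf : Measurable f) (hg : Good γ f) :
    Tendsto (fun n : ℕ => df γ f n) atTop (𝓝 0) := by
  obtain ⟨l, hl, hl2⟩ := hg
  have key := tendsto_measure_iInter_atTop (μ := (volume : Measure ℝ))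
    (s := fun n : ℕ => {s | s ∈ II γ ∧ (n:ℝ) < |f s|}) (fun n => by
      apply MeasurableSet.nullMeasurableSet
      exact (meas_II γ).inter (measurableSet_lt (measurable_const (a := (n:ℝ)))
        (show Measurable (fun s => |f s|) by fun_prop))) (by
      intro a b hab s hs
      exact ⟨hs.1, lt_of_le_of_lt (by exact_mod_cast hab) hs.2⟩) (by
      obtain ⟨n, hn⟩ := exists_nat_ge l
      exact ⟨n, ((df_anti γ f hn).trans_lt hl2).ne⟩)
  have he : (⋂ n : ℕ, {s | s ∈ II γ ∧ (n:ℝ) < |f s|}) = ∅ := by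
    ext s
    simp only [mem_iInter, mem_ofPred_eq, mem_empty_iff_false, iff_false, not_forall]
    obtain ⟨n, hn⟩ := exists_nat_ge |f s|
    exact ⟨n, fun h => absurd h.2 (not_lt.2 hn)⟩
  rw [he, measure_empty] at key
  exact key

lemma rear_nonneg (γ : ℝ≥0∞) (f : ℝ → ℝ) (t : ℝ) : 0 ≤ rear γ f t :=
  Real.sInf_nonneg (fun _ h => h.1.le)

lemma rear_le {γ : ℝ≥0∞} {f : ℝ → ℝ} {t l : ℝ} (hl : 0 < l) (h : df γ f l ≤ ENNReal.ofReal t) :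
    rear γ f t ≤ l := csInf_le ⟨0, fun _ h => h.1.le⟩ ⟨hl, h⟩

lemma rear_ne {γ : ℝ≥0∞} {f : ℝ → ℝ} (hf : Measurable f) (hg : Good γ f) {t : ℝ} (ht : 0 < t) :
    {l : ℝ | 0 < l ∧ df γ f l ≤ ENNReal.ofReal t}.Nonempty := by
  have h := (df_tendsto hf hg).eventually_le_const (u := ENNReal.ofReal t) (by simpa using ht)
  obtain ⟨n, hn, hn1⟩ := (h.and (eventually_ge_atTop 1)).exists
  exact ⟨n, by have : (1:ℝ) ≤ n := by exact_mod_cast hn1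
               linarith, hn⟩

lemma le_rear {γ : ℝ≥0∞} {f : ℝ → ℝ} (hf : Measurable f) (hg : Good γ f) {t a : ℝ} (ht : 0 < t)
    (h : ∀ l, 0 < l → df γ f l ≤ ENNReal.ofReal t → a ≤ l) : a ≤ rear γ f t :=
  le_csInf (rear_ne hf hg ht) (fun l hl => h l hl.1 hl.2)

lemma rear_bad {γ : ℝ≥0∞} {f : ℝ → ℝ} (hg : ¬ Good γ f) (t : ℝ) : rear γ f t = 0 := by
  have : {l : ℝ | 0 < l ∧ df γ f l ≤ ENNReal.ofReal t} = ∅ := by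
    ext l
    simp only [mem_ofPred_eq, mem_empty_iff_false, iff_false]
    rintro ⟨h1, h2⟩
    exact hg ⟨l, h1, h2.trans_lt ENNReal.ofReal_lt_top⟩
  rw [rear, this, Real.sInf_empty]

lemma rear_anti {γ : ℝ≥0∞} {f : ℝ → ℝ} (hf : Measurable f) :
    AntitoneOn (rear γ f) (Ioi 0) := by
  intro a ha b hb hab
  by_cases hg : Good γ f
  · apply le_rear hf hg ha
    intro l hl h
    exact rear_le hl (h.trans (ENNReal.ofReal_le_ofReal hab))
  · rw [rear_bad hg, rear_bad hg]

lemma rear_mono {γ : ℝ≥0∞} {h f : ℝ → ℝ} (hf : Measurable f) (hg : Good γ f)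
    (hh : ∀ t, |h t| ≤ |f t|) {t : ℝ} (ht : 0 < t) : rear γ h t ≤ rear γ f t := by
  apply le_rear hf hg ht
  intro l hl h1
  exact rear_le hl ((df_mono γ hh l).trans h1)

lemma df_div (γ : ℝ≥0∞) (f : ℝ → ℝ) {c : ℝ} (hc : 0 < c) (l : ℝ) :
    df γ (fun t => f t / c) l = df γ f (l * c) := by
  unfold df
  congr 1
  ext s
  simp only [mem_ofPred_eq, abs_div, abs_of_pos hc, lt_div_iff₀ hc]

lemma good_div {γ : ℝ≥0∞} {f : ℝ → ℝ} {c : ℝ} (hc : 0 < c) (hg : Good γ f) :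
    Good γ (fun t => f t / c) := by
  obtain ⟨l, h1, h2⟩ := hg
  refine ⟨l / c, by positivity, ?_⟩
  rw [df_div γ f hc, div_mul_cancel₀ _ hc.ne']
  exact h2

lemma good_div_iff {γ : ℝ≥0∞} {f : ℝ → ℝ} {c : ℝ} (hc : 0 < c) :
    Good γ (fun t => f t / c) ↔ Good γ f := by
  refine ⟨fun hg => ?_, good_div hc⟩
  obtain ⟨l, h1, h2⟩ := hg
  rw [df_div γ f hc] at h2
  exact ⟨l * c, by positivity, h2⟩

lemma rear_div {γ : ℝ≥0∞} {f : ℝ → ℝ} (hf : Measurable f) {c : ℝ} (hc : 0 < c) {t : ℝ}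
    (ht : 0 < t) : rear γ (fun t => f t / c) t = rear γ f t / c := by
  by_cases hg : Good γ f
  · apply le_antisymm
    · rw [le_div_iff₀ hc]
      apply le_rear hf hg ht
      intro l hl h
      rw [← le_div_iff₀ hc]
      apply rear_le (by positivity)
      rw [df_div γ f hc, div_mul_cancel₀ _ hc.ne']
      exact h
    · apply le_rear (hf.div_const c) (good_div hc hg) ht
      intro l hl h
      rw [div_le_iff₀ hc]
      rw [df_div γ f hc] at h
      exact rear_le (by positivity) h
  · rw [rear_bad hg, rear_bad (fun h => hg ((good_div_iff hc).1 h))]; simp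

/-- Orlicz functions are nonnegative. -/
lemma phi_nonneg {φ : ℝ → ℝ} (h : IsOrlicz φ) {t : ℝ} (ht : 0 ≤ t) : 0 ≤ φ t := by
  rcases ht.eq_or_lt with h0 | h0
  · rw [← h0, h.2.1]
  · exact (h.2.2 t h0).le

lemma phi_mono {φ : ℝ → ℝ} (h : IsOrlicz φ) : MonotoneOn φ (Ici 0) := by
  intro a ha b hb hab
  rcases (show (0:ℝ) ≤ a from ha).eq_or_lt with h0 | h0
  · rw [← h0, h.2.1]; exact phi_nonneg h hb
  have hb' : 0 < b := lt_of_lt_of_le h0 hab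
  have h1 := h.1.2 (show (0:ℝ) ∈ Ici (0:ℝ) by simp) hb (show 0 ≤ 1 - a / b by rw [sub_nonneg, div_le_one hb']; exact hab)
    (show 0 ≤ a / b by positivity) (by ring)
  simp only [smul_eq_mul, mul_zero, zero_add, h.2.1] at h1
  rw [div_mul_cancel₀ _ hb'.ne'] at h1
  have h2 : a / b ≤ 1 := by rw [div_le_one hb']; exact hab
  nlinarith [phi_nonneg h hb]

lemma phi_subgrad {φ : ℝ → ℝ} (h : IsOrlicz φ) (u : ℝ) (hu : 0 < u) :
    ∃ p : ℝ, ∀ x, 0 ≤ x → x * p - φ x ≤ u * p - φ u := by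
  let A : Set ℝ := {y | ∃ x, 0 ≤ x ∧ x < u ∧ y = (φ u - φ x) / (u - x)}
  have hub : ∀ z, u < z → ∀ y ∈ A, y ≤ (φ z - φ u) / (z - u) := by
    rintro z hz y ⟨x, hx, hxu, rfl⟩
    exact h.1.slope_mono_adjacent (show x ∈ Ici (0:ℝ) from hx)
      (show z ∈ Ici (0:ℝ) from hu.le.trans hz.le) hxu hz
  have hne : A.Nonempty := ⟨_, 0, le_rfl, hu, rfl⟩
  have hbd : BddAbove A := ⟨_, hub (u + 1) (by linarith)⟩
  refine ⟨sSup A, fun x hx => ?_⟩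
  rcases lt_trichotomy x u with h1 | h1 | h1
  · have := le_csSup hbd (show _ ∈ A from ⟨x, hx, h1, rfl⟩)
    rw [div_le_iff₀ (by linarith)] at this
    linarith
  · rw [h1]
  · have := csSup_le hne (hub x h1)
    rw [le_div_iff₀ (by linarith)] at this
    linarith

lemma exists_p {φ : ℝ → ℝ} (h : IsOrlicz φ) :
    ∃ p : ℝ → ℝ, p 0 = 0 ∧ (∀ u, 0 ≤ u → 0 ≤ p u) ∧ MonotoneOn p (Ici 0) ∧
      ∀ u, 0 ≤ u → ∀ x, 0 ≤ x → x * p u - φ x ≤ u * p u - φ u := by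
  choose! p hp using phi_subgrad h
  let q : ℝ → ℝ := fun u => if u = 0 then 0 else p u
  have hq : ∀ u, 0 ≤ u → ∀ x, 0 ≤ x → x * q u - φ x ≤ u * q u - φ u := by
    intro u hu x hx
    by_cases h0 : u = 0
    · simp [q, h0, h.2.1, phi_nonneg h hx]
    · simp only [q, h0, if_false]
      exact hp u (lt_of_le_of_ne hu (Ne.symm h0)) x hx
  refine ⟨q, by simp [q], ?_, ?_, hq⟩
  · intro u hu
    rcases hu.eq_or_lt with h0 | h0
    · simp [q, ← h0]
    · have := hq u hu 0 le_rfl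
      rw [h.2.1] at this
      have h3 := phi_nonneg h hu
      by_contra hc
      push Not at hc
      nlinarith
  · intro a ha b hb hab
    have h1 := hq a ha b hb
    have h2 := hq b hb a ha
    rcases hab.eq_or_lt with h0 | h0
    · rw [h0]
    · by_contra hc
      push Not at hc
      nlinarith

lemma conj_bdd {φ : ℝ → ℝ} (h : IsN φ) (v : ℝ) :
    BddAbove {x : ℝ | ∃ u : ℝ, 0 ≤ u ∧ x = u * v - φ u} := by
  obtain ⟨K, hK⟩ := eventually_atTop.1 (h.2.2.eventually_ge_atTop v)
  refine ⟨(max K 1) * |v|, ?_⟩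
  rintro x ⟨u, hu, rfl⟩
  have hp := phi_nonneg h.1 hu
  rcases le_total u (max K 1) with h1 | h1
  · have : u * v ≤ u * |v| := mul_le_mul_of_nonneg_left (le_abs_self v) hu
    have : u * |v| ≤ max K 1 * |v| := mul_le_mul_of_nonneg_right h1 (abs_nonneg v)
    linarith
  · have h2 := hK u ((le_max_left _ _).trans h1)
    have h3 : 0 < u := lt_of_lt_of_le (by simp) h1
    rw [le_div_iff₀ h3] at h2
    have : 0 ≤ max K 1 * |v| := by positivity
    linarith

lemma young {φ : ℝ → ℝ} (h : IsN φ) {u : ℝ} (hu : 0 ≤ u) (v : ℝ) : u * v ≤ φ u + conj φ v := by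
  have := le_csSup (conj_bdd h v) ⟨u, hu, rfl⟩
  unfold conj
  linarith

lemma conj_nonneg {φ : ℝ → ℝ} (h : IsN φ) (v : ℝ) : 0 ≤ conj φ v := by
  have := young h le_rfl v
  rw [h.1.2.1] at this
  linarith

lemma conj_le {φ : ℝ → ℝ} {v a : ℝ} (h : ∀ u, 0 ≤ u → u * v - φ u ≤ a) : conj φ v ≤ a := by
  unfold conj
  refine csSup_le ⟨0 * v - φ 0, 0, le_rfl, rfl⟩ ?_
  rintro x ⟨u, hu, rfl⟩
  exact h u hu

lemma conj_mono {φ : ℝ → ℝ} (h : IsN φ) : Monotone (conj φ) := by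
  intro a b hab
  apply conj_le
  intro u hu
  have := young h hu b
  nlinarith

lemma conj_zero {φ : ℝ → ℝ} (h : IsN φ) : conj φ 0 = 0 := by
  apply le_antisymm _ (conj_nonneg h 0)
  apply conj_le
  intro u hu
  have := phi_nonneg h.1 hu
  linarith

lemma conj_div {φ : ℝ → ℝ} (h : IsN φ) {r : ℝ} (hr : 1 ≤ r) (v : ℝ) :
    conj φ (v / r) ≤ conj φ v / r := by
  have hr0 : 0 < r := by linarith
  apply conj_le
  intro u hu
  rw [le_div_iff₀ hr0]
  have h1 := young h hu v
  have h2 := phi_nonneg h.1 hu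
  have h3 : (u * (v / r) - φ u) * r = u * v - φ u * r := by field_simp
  rw [h3]
  nlinarith

/-- The weight is integrable near the origin. -/
lemma W_fin {γ : ℝ≥0∞} {w : ℝ → ℝ} (hw : IsWeight γ w) (T : ℝ) (hT : 0 ≤ T) :
    ∫⁻ t in JJ γ ∩ Iic T, ENNReal.ofReal (w t) < ⊤ := by
  obtain ⟨hm, hpos, hanti, hint, -⟩ := hw
  have hfin : ∀ t ∈ II γ, ∫⁻ s in Icc 0 t, ENNReal.ofReal (w s) < ⊤ := by
    intro t ht
    exact (hasFiniteIntegral_iff_ofReal ((ae_restrict_iff' measurableSet_Icc).2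
      (Eventually.of_forall fun s hs => (hpos s ⟨hs.1,
        (ENNReal.ofReal_le_ofReal hs.2).trans_lt ht.2⟩).le))).1 (hint t ht).2
  by_cases hTI : T ∈ II γ
  · refine lt_of_le_of_lt (lintegral_mono_set ?_) (hfin T hTI)
    rintro s ⟨h1, h2⟩
    exact ⟨h1.1.1, h2⟩
  · have hγ : γ ≤ ENNReal.ofReal T := by
      by_contra hc
      exact hTI ⟨hT, not_le.1 hc⟩
    have hγt : γ ≠ ⊤ := ne_top_of_le_ne_top ENNReal.ofReal_ne_top hγ
    rcases (JJ γ).eq_empty_or_nonempty with he | ⟨t0, ht0⟩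
    · simp [he]
    · have hsub : JJ γ ∩ Iic T ⊆ Icc 0 t0 ∪ (II γ ∩ Ici t0) := by
        rintro s ⟨h1, h2⟩
        rcases le_total s t0 with h3 | h3
        · exact Or.inl ⟨h1.1.1, h3⟩
        · exact Or.inr ⟨h1.1, h3⟩
      refine lt_of_le_of_lt ((lintegral_mono_set hsub).trans (lintegral_union_le _ _ _)) ?_
      refine ENNReal.add_lt_top.2 ⟨hfin t0 ht0.1, ?_⟩
      have : ∫⁻ s in II γ ∩ Ici t0, ENNReal.ofReal (w s) ≤
          ∫⁻ s in II γ ∩ Ici t0, ENNReal.ofReal (w t0) := by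
        apply setLIntegral_mono measurable_const
        rintro s ⟨h1, h2⟩
        exact ENNReal.ofReal_le_ofReal (hanti t0 ht0.1 s h1 h2)
      refine lt_of_le_of_lt this ?_
      rw [setLIntegral_const]
      exact ENNReal.mul_lt_top ENNReal.ofReal_lt_top
        ((measure_mono inter_subset_left).trans_lt (vol_II hγt))

/-- The remainder `f - f_n`. -/
def hh (f : ℝ → ℝ) (n : ℕ) : ℝ → ℝ :=
  fun t => f t - ({s : ℝ | 1 / (n:ℝ) ≤ |f s| ∧ |f s| ≤ (n:ℝ)}.indicator f) t

lemma hh_in {f : ℝ → ℝ} {n : ℕ} {t : ℝ} (h : 1 / (n:ℝ) ≤ |f t| ∧ |f t| ≤ (n:ℝ)) :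
    hh f n t = 0 := by
  unfold hh
  rw [indicator_of_mem (show t ∈ {s : ℝ | 1 / (n:ℝ) ≤ |f s| ∧ |f s| ≤ (n:ℝ)} from h)]
  simp

lemma hh_out {f : ℝ → ℝ} {n : ℕ} {t : ℝ} (h : ¬ (1 / (n:ℝ) ≤ |f t| ∧ |f t| ≤ (n:ℝ))) :
    hh f n t = f t := by
  unfold hh
  rw [indicator_of_notMem (show t ∉ {s : ℝ | 1 / (n:ℝ) ≤ |f s| ∧ |f s| ≤ (n:ℝ)} from h)]
  simp

lemma hh_abs (f : ℝ → ℝ) (n : ℕ) (t : ℝ) : |hh f n t| ≤ |f t| := by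
  by_cases h : 1 / (n:ℝ) ≤ |f t| ∧ |f t| ≤ (n:ℝ)
  · rw [hh_in h]; simp
  · rw [hh_out h]

lemma hh_meas {f : ℝ → ℝ} (hf : Measurable f) (n : ℕ) : Measurable (hh f n) := by
  unfold hh
  refine hf.sub (hf.indicator ?_)
  have ha : Measurable (fun s => |f s|) := by fun_prop
  exact (measurableSet_le (measurable_const (a := 1 / (n:ℝ))) ha).inter
    (measurableSet_le ha (measurable_const (a := (n:ℝ))))

lemma df_hh_big (γ : ℝ≥0∞) (f : ℝ → ℝ) (n : ℕ) {l : ℝ} (hl : (n:ℝ) ≤ l) :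
    df γ (hh f n) l = df γ f l := by
  apply le_antisymm (df_mono γ (hh_abs f n) l)
  apply measure_mono
  rintro s ⟨h1, h2⟩
  refine ⟨h1, ?_⟩
  rw [hh_out (fun h => by linarith [h.2])]
  exact h2

lemma df_hh_small (γ : ℝ≥0∞) (f : ℝ → ℝ) (n : ℕ) {l : ℝ} (hl : 1 / (n:ℝ) ≤ l) :
    df γ (hh f n) l ≤ df γ f n := by
  apply measure_mono
  rintro s ⟨h1, h2⟩
  refine ⟨h1, ?_⟩
  have h3 := hh_abs f n s
  by_contra hc
  have hl0 : 0 ≤ 1 / (n:ℝ) := by positivity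
  rw [hh_in ⟨by linarith, not_lt.1 hc⟩, abs_zero] at h2
  linarith

lemma good_hh {γ : ℝ≥0∞} {f : ℝ → ℝ} (n : ℕ) (h : Good γ f) : Good γ (hh f n) := by
  obtain ⟨l, h1, h2⟩ := h
  exact ⟨l, h1, (df_mono γ (hh_abs f n) l).trans_lt h2⟩

lemma bad_hh {γ : ℝ≥0∞} {f : ℝ → ℝ} (n : ℕ) (h : Good γ (hh f n)) : Good γ f := by
  obtain ⟨l, h1, h2⟩ := h
  refine ⟨max l n, lt_max_of_lt_left h1, ?_⟩
  rw [← df_hh_big γ f n (le_max_right l n)]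
  exact (df_anti γ _ (le_max_left l n)).trans_lt h2

lemma rear_hh_le {γ : ℝ≥0∞} {f : ℝ → ℝ} (hf : Measurable f) (n : ℕ) {t : ℝ} (ht : 0 < t) :
    rear γ (hh f n) t ≤ rear γ f t := by
  by_cases hg : Good γ f
  · exact rear_mono hf hg (hh_abs f n) ht
  · rw [rear_bad (fun h => hg (bad_hh n h))]
    exact rear_nonneg _ _ _

lemma rear_hh_tendsto {γ : ℝ≥0∞} {f : ℝ → ℝ} (hf : Measurable f) {t : ℝ} (ht : 0 < t) :
    Tendsto (fun n : ℕ => rear γ (hh f n) t) atTop (𝓝 0) := by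
  by_cases hg : Good γ f
  · rw [Metric.tendsto_atTop']
    intro ε hε
    have h1 := (df_tendsto hf hg).eventually_le_const (u := ENNReal.ofReal t) (by simpa using ht)
    have h2 : ∀ᶠ n : ℕ in atTop, 1 / (n:ℝ) ≤ ε / 2 :=
      (tendsto_one_div_atTop_nhds_zero_nat (𝕜 := ℝ)).eventually_le_const (by positivity)
    obtain ⟨N, hN⟩ := eventually_atTop.1 (h1.and h2)
    refine ⟨N, fun n hn => ?_⟩
    obtain ⟨h3, h4⟩ := hN n hn.le
    rw [Real.dist_eq, sub_zero, abs_of_nonneg (rear_nonneg _ _ _)]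
    have := rear_le (t := t) (f := hh f n) (γ := γ) (show 0 < ε / 2 by positivity)
      ((df_hh_small γ f n h4).trans h3)
    linarith
  · simp only [rear_bad (fun h => hg (bad_hh _ h))]
    exact tendsto_const_nhds

lemma rho_div {γ : ℝ≥0∞} {f : ℝ → ℝ} (hf : Measurable f) (φ w : ℝ → ℝ) {c : ℝ} (hc : 0 < c) :
    rho γ φ w (fun t => f t / c) =
      ∫⁻ t in JJ γ, ENNReal.ofReal (φ (rear γ f t / c) * w t) := by
  unfold rho
  rw [lint_JJ]
  apply setLIntegral_congr_fun (meas_JJ γ)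
  intro t ht
  simp only
  rw [rear_div hf hc ht.2]

lemma aem_phi {γ : ℝ≥0∞} {f φ w : ℝ → ℝ} (hf : Measurable f) (hw : Measurable w)
    (hφ : MonotoneOn φ (Ici 0)) {c : ℝ} (hc : 0 < c) :
    AEMeasurable (fun t => ENNReal.ofReal (φ (rear γ f t / c) * w t))
      (volume.restrict (JJ γ)) := by
  apply AEMeasurable.ennreal_ofReal
  apply AEMeasurable.mul _ hw.aemeasurable
  apply aemeasurable_restrict_of_antitoneOn (meas_JJ γ)
  intro a ha b hb hab
  apply hφ (div_nonneg (rear_nonneg _ _ _) hc.le) (div_nonneg (rear_nonneg _ _ _) hc.le)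
  have := rear_anti (γ := γ) hf ha.2 hb.2 hab
  gcongr

lemma phi_cont0 {φ : ℝ → ℝ} (h : IsN φ) {x : ℕ → ℝ} (hx0 : ∀ n, 0 ≤ x n)
    (hx : Tendsto x atTop (𝓝 0)) : Tendsto (fun n => φ (x n)) atTop (𝓝 0) := by
  have h1 : 0 ≤ φ 1 := phi_nonneg h.1 zero_le_one
  have hb : ∀ᶠ n in atTop, φ (x n) ≤ x n * φ 1 := by
    filter_upwards [hx.eventually_le_const (show (0:ℝ) < 1 by norm_num)] with n hn
    have h2 := h.1.1.2 (show (0:ℝ) ∈ Ici (0:ℝ) by simp) (show (1:ℝ) ∈ Ici (0:ℝ) by simp)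
      (show 0 ≤ 1 - x n by linarith) (hx0 n) (by ring)
    simpa [h.1.2.1] using h2
  have h3 : Tendsto (fun n => x n * φ 1) atTop (𝓝 0) := by simpa using hx.mul_const (φ 1)
  exact tendsto_of_tendsto_of_tendsto_of_le_of_le' tendsto_const_nhds h3
    (Eventually.of_forall fun n => phi_nonneg h.1 (hx0 n)) hb

/-- Modular convergence of the remainders. -/
lemma rho_hh_tendsto {γ : ℝ≥0∞} {f φ w : ℝ → ℝ} (hw : IsWeight γ w) (hφ : IsN φ)
    (hf : Measurable f) {c : ℝ} (hc : 0 < c) (hr : rho γ φ w (fun t => f t / c) < ⊤) :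
    Tendsto (fun n => rho γ φ w (fun t => hh f n t / c)) atTop (𝓝 0) := by
  rw [rho_div hf φ w hc] at hr
  have e : ∀ n, rho γ φ w (fun t => hh f n t / c) = _ := fun n => rho_div (hh_meas hf n) φ w hc
  simp only [e]
  have key := tendsto_lintegral_of_dominated_convergence' (μ := volume.restrict (JJ γ))
    (F := fun n t => ENNReal.ofReal (φ (rear γ (hh f n) t / c) * w t)) (f := fun _ => 0)
    (fun t => ENNReal.ofReal (φ (rear γ f t / c) * w t))
    (fun n => aem_phi (hh_meas hf n) hw.1 (phi_mono hφ.1) hc)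
    (fun n => (ae_restrict_iff' (meas_JJ γ)).2 (Eventually.of_forall fun t ht => by
      apply ENNReal.ofReal_le_ofReal
      apply mul_le_mul_of_nonneg_right _ (hw.2.1 t ht.1).le
      apply phi_mono hφ.1 (div_nonneg (rear_nonneg _ _ _) hc.le)
        (div_nonneg (rear_nonneg _ _ _) hc.le)
      have := rear_hh_le (γ := γ) hf n ht.2
      gcongr)) hr.ne
    ((ae_restrict_iff' (meas_JJ γ)).2 (Eventually.of_forall fun t ht => by
      have h1 := (rear_hh_tendsto (γ := γ) hf ht.2).div_const c
      rw [zero_div] at h1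
      have h2 := (phi_cont0 hφ (fun n => div_nonneg (rear_nonneg _ _ _) hc.le) h1).mul_const (w t)
      rw [zero_mul] at h2
      simpa using ENNReal.tendsto_ofReal h2))
  simpa using key

lemma mid_fin {γ : ℝ≥0∞} {f φ w : ℝ → ℝ} (hw : IsWeight γ w) (hφ : IsN φ)
    (hf : Measurable f) (hg : Good γ f) {c : ℝ} (hc : 0 < c)
    (hr : rho γ φ w (fun t => f t / c) < ⊤) {l : ℝ} (hl : 0 < l) : df γ f l < ⊤ := by
  by_contra hn
  have htop : df γ f l = ⊤ := by simpa using hn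
  have hγ : γ = ⊤ := by
    by_contra hγ
    refine hn ((measure_mono ?_).trans_lt (vol_II hγ))
    exact fun s hs => hs.1
  have hge : ∀ t, 0 < t → l ≤ rear γ f t := by
    intro t ht
    apply le_rear hf hg ht
    intro a ha h
    by_contra hc
    push Not at hc
    have := (df_anti γ f hc.le).trans h
    rw [htop] at this
    simp at this
  rw [rho_div hf φ w hc] at hr
  have h1 : ∫⁻ t in JJ γ, ENNReal.ofReal (φ (l / c)) * ENNReal.ofReal (w t) ≤
      ∫⁻ t in JJ γ, ENNReal.ofReal (φ (rear γ f t / c) * w t) := by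
    apply setLIntegral_mono' (meas_JJ γ)
    intro t ht
    rw [← ENNReal.ofReal_mul (phi_nonneg hφ.1 (by positivity))]
    apply ENNReal.ofReal_le_ofReal
    apply mul_le_mul_of_nonneg_right _ (hw.2.1 t ht.1).le
    apply phi_mono hφ.1 (show (0:ℝ) ≤ l / c by positivity) (div_nonneg (rear_nonneg _ _ _) hc.le)
    have := hge t ht.2
    gcongr
  rw [lintegral_const_mul _ hw.1.ennreal_ofReal, ← lint_JJ, hw.2.2.2.2 hγ,
    ENNReal.mul_top (by simpa using hφ.1.2.2 (l / c) (by positivity))] at h1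
  exact absurd (h1.trans_lt hr) (by simp)

/-- Removing the middle part does not change finiteness of the modular. -/
lemma rho_fin_of_hh {γ : ℝ≥0∞} {f φ w : ℝ → ℝ} (hw : IsWeight γ w) (hφ : IsN φ)
    (hf : Measurable f) (hg : Good γ f) {c0 : ℝ} (hc0 : 0 < c0)
    (hr : rho γ φ w (fun t => f t / c0) < ⊤) {n : ℕ} (hn : 1 ≤ n) {c : ℝ} (hc : 0 < c)
    (hh1 : rho γ φ w (fun t => hh f n t / c) < ⊤) : rho γ φ w (fun t => f t / c) < ⊤ := by
  have hn0 : (0:ℝ) < n := by exact_mod_cast hn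
  have hgh := good_hh n hg
  have hhm := hh_meas hf n
  set M' := volume {s | s ∈ II γ ∧ 1 / (n:ℝ) ≤ |f s| ∧ |f s| ≤ n} with hM'
  have hM'fin : M' < ⊤ := by
    refine lt_of_le_of_lt (measure_mono ?_) (mid_fin hw hφ hf hg hc0 hr
      (show 0 < 1 / (2 * (n:ℝ)) by positivity))
    rintro s ⟨h1, h2, h3⟩
    refine ⟨h1, lt_of_lt_of_le ?_ h2⟩
    apply one_div_lt_one_div_of_lt hn0
    linarith
  set M := M'.toReal with hM
  have hM0 : 0 ≤ M := ENNReal.toReal_nonneg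
  have hMM : ENNReal.ofReal M = M' := ENNReal.ofReal_toReal hM'fin.ne
  have hdf : ∀ l, df γ f l ≤ df γ (hh f n) l + M' := by
    intro l
    refine le_trans (measure_mono ?_) (measure_union_le _ _)
    rintro s ⟨h1, h2⟩
    by_cases h : 1 / (n:ℝ) ≤ |f s| ∧ |f s| ≤ (n:ℝ)
    · exact Or.inr ⟨h1, h⟩
    · refine Or.inl ⟨h1, ?_⟩
      rw [hh_out h]; exact h2
  have hshift : ∀ t, 0 < t → rear γ f (t + M) ≤ rear γ (hh f n) t := by
    intro t ht
    apply le_rear hhm hgh ht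
    intro l hl h
    apply rear_le hl
    rw [ENNReal.ofReal_add ht.le hM0, hMM]
    exact (hdf l).trans (by gcongr)
  have hmax : ∀ t, 0 < t → rear γ f t ≤ max (n:ℝ) (rear γ (hh f n) t) := by
    intro t ht
    by_contra hcon
    push Not at hcon
    obtain ⟨h1, h2⟩ := max_lt_iff.1 hcon
    refine absurd h2 (not_lt.2 ?_)
    apply le_rear hhm hgh ht
    intro l hl h
    have h3 : rear γ f t ≤ max l n := by
      apply rear_le (lt_max_of_lt_left hl)
      rw [← df_hh_big γ f n (le_max_right l n)]
      exact (df_anti γ _ (le_max_left l n)).trans h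
    rcases le_max_iff.1 h3 with h4 | h4
    · exact h4
    · linarith
  rw [rho_div hf φ w hc]
  rw [rho_div hhm φ w hc] at hh1
  have hsub : JJ γ ⊆ (JJ γ ∩ Iic M) ∪ (JJ γ ∩ Ioi M) := by
    intro s hs
    rcases le_or_gt s M with h | h
    · exact Or.inl ⟨hs, h⟩
    · exact Or.inr ⟨hs, h⟩
  refine lt_of_le_of_lt ((lintegral_mono_set hsub).trans (lintegral_union_le _ _ _)) ?_
  refine ENNReal.add_lt_top.2 ⟨?_, ?_⟩
  · have h1 : ∫⁻ t in JJ γ ∩ Iic M, ENNReal.ofReal (φ (rear γ f t / c) * w t) ≤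
        ∫⁻ t in JJ γ ∩ Iic M, (ENNReal.ofReal (φ (n / c)) * ENNReal.ofReal (w t) +
          ENNReal.ofReal (φ (rear γ (hh f n) t / c) * w t)) := by
      apply setLIntegral_mono' ((meas_JJ γ).inter measurableSet_Iic)
      rintro t ⟨ht, -⟩
      have hwt := (hw.2.1 t ht.1).le
      have p1 : 0 ≤ φ (n / c) := phi_nonneg hφ.1 (by positivity)
      have p2 : 0 ≤ φ (rear γ (hh f n) t / c) :=
        phi_nonneg hφ.1 (div_nonneg (rear_nonneg _ _ _) hc.le)
      rw [← ENNReal.ofReal_mul p1, ← ENNReal.ofReal_add (by positivity) (by positivity), ← add_mul]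
      apply ENNReal.ofReal_le_ofReal
      apply mul_le_mul_of_nonneg_right _ hwt
      rcases le_max_iff.1 (hmax t ht.2) with h4 | h4
      · have : φ (rear γ f t / c) ≤ φ (n / c) := by
          apply phi_mono hφ.1 (div_nonneg (rear_nonneg _ _ _) hc.le)
            (show (0:ℝ) ≤ n / c by positivity)
          gcongr
        linarith
      · have : φ (rear γ f t / c) ≤ φ (rear γ (hh f n) t / c) := by
          apply phi_mono hφ.1 (div_nonneg (rear_nonneg _ _ _) hc.le)
            (div_nonneg (rear_nonneg _ _ _) hc.le)
          gcongr
        linarith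
    refine lt_of_le_of_lt h1 ?_
    rw [lintegral_add_left (hw.1.ennreal_ofReal.const_mul _),
      lintegral_const_mul _ hw.1.ennreal_ofReal]
    exact ENNReal.add_lt_top.2 ⟨ENNReal.mul_lt_top ENNReal.ofReal_lt_top (W_fin hw M hM0),
      (lintegral_mono_set inter_subset_left).trans_lt hh1⟩
  · set B : ℝ → ℝ≥0∞ := fun t => ENNReal.ofReal (φ (rear γ (hh f n) t / c) * w t) with hB
    have h1 : ∫⁻ t in JJ γ ∩ Ioi M, ENNReal.ofReal (φ (rear γ f t / c) * w t) ≤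
        ∫⁻ t in JJ γ ∩ Ioi M, (JJ γ).indicator B (t - M) := by
      apply setLIntegral_mono' ((meas_JJ γ).inter measurableSet_Ioi)
      rintro t ⟨ht, htM⟩
      have htM : M < t := htM
      have hs : t - M ∈ JJ γ := ⟨⟨by linarith, (ENNReal.ofReal_le_ofReal (by linarith)).trans_lt
        ht.1.2⟩, show 0 < t - M by linarith⟩
      rw [indicator_of_mem hs]
      apply ENNReal.ofReal_le_ofReal
      have h2 := hshift (t - M) hs.2
      rw [sub_add_cancel] at h2
      apply mul_le_mul _ (hw.2.2.1 _ hs.1 _ ht.1 (by linarith)) (hw.2.1 t ht.1).le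
        (phi_nonneg hφ.1 (div_nonneg (rear_nonneg _ _ _) hc.le))
      apply phi_mono hφ.1 (div_nonneg (rear_nonneg _ _ _) hc.le)
        (div_nonneg (rear_nonneg _ _ _) hc.le)
      gcongr
    refine lt_of_le_of_lt (h1.trans (setLIntegral_le_lintegral _ _)) ?_
    rw [lintegral_sub_right_eq_self (fun t => (JJ γ).indicator B t) M,
      lintegral_indicator (meas_JJ γ)]
    exact hh1

lemma good_anti {γ : ℝ≥0∞} {g : ℝ → ℝ} (hg : Antitone g) (h0 : ∀ t, 0 ≤ g t) : Good γ g := by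
  refine ⟨g 0 + 1, by linarith [h0 0], ?_⟩
  have : {s | s ∈ II γ ∧ g 0 + 1 < |g s|} = ∅ := by
    ext s
    simp only [mem_ofPred_eq, mem_empty_iff_false, iff_false]
    rintro ⟨h1, h2⟩
    rw [abs_of_nonneg (h0 s)] at h2
    linarith [hg h1.1]
  rw [df, this]
  simp

lemma rear_anti_le {γ : ℝ≥0∞} {g : ℝ → ℝ} (hg : Antitone g) (h0 : ∀ t, 0 ≤ g t) {t : ℝ} :
    rear γ g t ≤ g t := by
  apply le_of_forall_gt_imp_ge_of_dense
  intro l hl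
  apply rear_le (lt_of_le_of_lt (h0 t) hl)
  have : {s | s ∈ II γ ∧ l < |g s|} ⊆ Icc 0 t := by
    rintro s ⟨h1, h2⟩
    rw [abs_of_nonneg (h0 s)] at h2
    refine ⟨h1.1, ?_⟩
    by_contra hc
    push Not at hc
    linarith [hg hc.le]
  refine (measure_mono this).trans ?_
  simp

lemma le_rear_anti {γ : ℝ≥0∞} {g : ℝ → ℝ} (hg : Antitone g) (h0 : ∀ t, 0 ≤ g t) {t : ℝ}
    (ht : t ∈ JJ γ) (hc : ContinuousAt g t) : g t ≤ rear γ g t := by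
  apply le_rear hg.measurable (good_anti hg h0) ht.2
  intro l hl h
  by_contra hcon
  push Not at hcon
  have e1 : ∀ᶠ s in 𝓝[>] t, l < g s :=
    (hc.eventually_const_lt hcon).filter_mono nhdsWithin_le_nhds
  have e2 : ∀ᶠ s in 𝓝[>] t, ENNReal.ofReal s < γ :=
    (ENNReal.continuous_ofReal.continuousAt.eventually_lt_const ht.1.2).filter_mono
      nhdsWithin_le_nhds
  obtain ⟨s, ⟨h1, h2⟩, h3⟩ := ((e1.and e2).and self_mem_nhdsWithin).exists
  have h3 : t < s := h3
  have ht0 : 0 < t := ht.2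
  have h4 : ENNReal.ofReal s ≤ df γ g l := by
    have : Ioc 0 s ⊆ {s | s ∈ II γ ∧ l < |g s|} := by
      rintro x ⟨hx1, hx2⟩
      refine ⟨⟨hx1.le, (ENNReal.ofReal_le_ofReal hx2).trans_lt h2⟩, ?_⟩
      rw [abs_of_nonneg (h0 x)]
      exact h1.trans_le (hg hx2)
    calc ENNReal.ofReal s = volume (Ioc 0 s) := by simp
      _ ≤ _ := measure_mono this
  have h5 := h4.trans h
  rw [ENNReal.ofReal_le_ofReal_iff ht0.le] at h5
  linarith

lemma rear_anti_ae {γ : ℝ≥0∞} {g : ℝ → ℝ} (hg : Antitone g) (h0 : ∀ t, 0 ≤ g t) :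
    ∀ᵐ t ∂(volume.restrict (JJ γ)), rear γ g t = g t := by
  rw [ae_restrict_iff' (meas_JJ γ)]
  have h1 : ∀ᵐ t : ℝ ∂volume, ContinuousAt g t := by
    rw [ae_iff]
    exact hg.countable_not_continuousAt.measure_zero _
  filter_upwards [h1] with t ht htJ
  exact le_antisymm (rear_anti_le hg h0) (le_rear_anti hg h0 htJ ht)

/-- Truncation of the rearrangement. -/
def HN (γ : ℝ≥0∞) (h : ℝ → ℝ) (N : ℕ) (t : ℝ) : ℝ :=
  if t ≤ 0 then N else if t < N then min (rear γ h t) N else 0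

lemma HN_nonneg (γ : ℝ≥0∞) (h : ℝ → ℝ) (N : ℕ) (t : ℝ) : 0 ≤ HN γ h N t := by
  unfold HN
  split_ifs
  · positivity
  · exact le_min (rear_nonneg _ _ _) (by positivity)
  · exact le_rfl

lemma HN_le (γ : ℝ≥0∞) (h : ℝ → ℝ) (N : ℕ) (t : ℝ) : HN γ h N t ≤ N := by
  unfold HN
  split_ifs
  · exact le_rfl
  · exact min_le_right _ _
  · positivity

lemma HN_le_rear (γ : ℝ≥0∞) (h : ℝ → ℝ) (N : ℕ) {t : ℝ} (ht : 0 < t) :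
    HN γ h N t ≤ rear γ h t := by
  unfold HN
  rw [if_neg (not_le.2 ht)]
  split_ifs
  · exact min_le_left _ _
  · exact rear_nonneg _ _ _

lemma HN_anti {γ : ℝ≥0∞} {h : ℝ → ℝ} (hh : Measurable h) (N : ℕ) : Antitone (HN γ h N) := by
  intro a b hab
  by_cases ha : a ≤ 0
  · rw [show HN γ h N a = N by simp [HN, ha]]
    exact HN_le _ _ _ _
  · have hb : ¬ b ≤ 0 := fun h => ha (hab.trans h)
    by_cases hbN : b < N
    · have haN : a < N := lt_of_le_of_lt hab hbN
      simp only [HN, ha, hb, hbN, haN, if_true, if_false]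
      exact min_le_min_right _ (rear_anti hh (not_le.1 ha) (not_le.1 hb) hab)
    · rw [show HN γ h N b = 0 by simp [HN, hb, hbN]]
      exact HN_nonneg _ _ _ _

lemma HN_eventually (γ : ℝ≥0∞) (h : ℝ → ℝ) {t : ℝ} (ht : 0 < t) :
    ∀ᶠ N : ℕ in atTop, HN γ h N t = rear γ h t := by
  have h1 := tendsto_natCast_atTop_atTop (R := ℝ)
  filter_upwards [h1.eventually_gt_atTop t, h1.eventually_ge_atTop (rear γ h t)] with N h2 h3
  simp [HN, not_le.2 ht, h2, h3]

/-- The key estimate: small Orlicz norm gives a bounded modular of truncations. -/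
lemma trunc_bound {γ : ℝ≥0∞} {h φ w : ℝ → ℝ} (hw : IsWeight γ w) (hφ : IsN φ)
    (hh : Measurable h) {c : ℝ} (hc : 0 < c) (ho : orl γ φ w h < ENNReal.ofReal c) (N : ℕ) :
    ∫⁻ t in JJ γ, ENNReal.ofReal (φ (HN γ h N t / c) * w t) ≤ 1 := by
  obtain ⟨p, hp0, hpn, hpm, hps⟩ := exists_p hφ.1
  have hH0 := HN_nonneg γ h N
  have hHc : ∀ t, 0 ≤ HN γ h N t / c := fun t => div_nonneg (hH0 t) hc.le
  have hHa := HN_anti (γ := γ) hh N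
  set g : ℝ → ℝ := fun t => p (HN γ h N t / c) with hg
  have hg0 : ∀ t, 0 ≤ g t := fun t => hpn _ (hHc t)
  have hga : Antitone g := by
    intro a b hab
    apply hpm (hHc b) (hHc a)
    have := hHa hab
    gcongr
  have hgm : Measurable g := hga.measurable
  have hrear := rear_anti_ae (γ := γ) hga hg0
  have hwJ : ∀ t ∈ JJ γ, 0 ≤ w t := fun t ht => (hw.2.1 t ht.1).le
  set R := ∫⁻ t in JJ γ, ENNReal.ofReal (conj φ (g t) * w t) with hR
  set Q := ∫⁻ t in JJ γ, ENNReal.ofReal (φ (HN γ h N t / c) * w t) with hQ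
  set K := ∫⁻ t in JJ γ, ENNReal.ofReal (HN γ h N t * g t * w t) with hK
  have hφHm : Measurable (fun t => φ (HN γ h N t / c)) := by
    apply Antitone.measurable
    intro a b hab
    apply phi_mono hφ.1 (hHc b) (hHc a)
    have := hHa hab
    gcongr
  have hcjm : Measurable (fun t => conj φ (g t)) := (conj_mono hφ).measurable.comp hgm
  have hRfin : R < ⊤ := by
    have h1 : R ≤ ∫⁻ t in JJ γ, (Iic (N:ℝ)).indicator
        (fun t => ENNReal.ofReal (conj φ (p (N / c))) * ENNReal.ofReal (w t)) t := by
      apply setLIntegral_mono' (meas_JJ γ)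
      intro t ht
      by_cases htN : t ∈ Iic (N:ℝ)
      · rw [indicator_of_mem htN, ← ENNReal.ofReal_mul (conj_nonneg hφ _)]
        apply ENNReal.ofReal_le_ofReal
        apply mul_le_mul_of_nonneg_right _ (hwJ t ht)
        apply conj_mono hφ
        apply hpm (hHc t) (show (0:ℝ) ≤ N / c by positivity)
        have := HN_le γ h N t
        gcongr
      · have ht0 : (0:ℝ) < t := ht.2
        have htN' : ¬ t < N := fun h => htN h.le
        have : HN γ h N t = 0 := by simp [HN, not_le.2 ht0, htN']
        simp [hg, this, hp0, conj_zero hφ]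
    refine lt_of_le_of_lt h1 ?_
    rw [lintegral_indicator measurableSet_Iic, Measure.restrict_restrict measurableSet_Iic,
      lintegral_const_mul _ hw.1.ennreal_ofReal, inter_comm]
    exact ENNReal.mul_lt_top ENNReal.ofReal_lt_top (W_fin hw N (by positivity))
  have hKeq : K = ENNReal.ofReal c * (Q + R) := by
    rw [hQ, hR, ← lintegral_add_left (show Measurable (fun t => ENNReal.ofReal
      (φ (HN γ h N t / c) * w t)) from (hφHm.mul hw.1).ennreal_ofReal),
      ← lintegral_const_mul' _ _ ENNReal.ofReal_ne_top]
    apply setLIntegral_congr_fun (meas_JJ γ)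
    intro t ht
    have hwt := hwJ t ht
    have p1 := phi_nonneg hφ.1 (hHc t)
    have p2 := conj_nonneg hφ (g t)
    have hy : HN γ h N t / c * g t = φ (HN γ h N t / c) + conj φ (g t) := by
      apply le_antisymm (young hφ (hHc t) _)
      have : conj φ (g t) ≤ HN γ h N t / c * g t - φ (HN γ h N t / c) :=
        conj_le (fun x hx => hps _ (hHc t) x hx)
      linarith
    simp only
    rw [← ENNReal.ofReal_add (by positivity) (by positivity), ← ENNReal.ofReal_mul hc.le,
      ← add_mul, ← hy]
    congr 1
    field_simp
  have hrhog : ∀ r : ℝ, 0 < r → ∀ ψ : ℝ → ℝ, rho γ ψ w (fun t => g t / r) =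
      ∫⁻ t in JJ γ, ENNReal.ofReal (ψ (g t / r) * w t) := by
    intro r hr ψ
    rw [rho_div hgm ψ w hr]
    apply lintegral_congr_ae
    filter_upwards [hrear] with t ht
    rw [ht]
  have hbound : ∀ r : ℝ, 0 < r → rho γ (conj φ) w (fun t => g t / r) ≤ 1 →
      K ≤ ENNReal.ofReal r * orl γ φ w h := by
    intro r hr h1
    have h2 : ∫⁻ t in II γ, ENNReal.ofReal (rear γ h t * rear γ (fun t => g t / r) t * w t) ≤
        orl γ φ w h := by
      unfold orl
      exact le_iSup₂_of_le (fun t => g t / r) ⟨hgm.div_const r, h1⟩ le_rfl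
    rw [lint_JJ] at h2
    refine le_trans ?_ (mul_le_mul_right h2 _)
    rw [← lintegral_const_mul' _ _ ENNReal.ofReal_ne_top]
    apply lintegral_mono_ae
    filter_upwards [hrear, ae_restrict_mem (meas_JJ γ)] with t ht htJ
    rw [rear_div hgm hr htJ.2, ht, ← ENNReal.ofReal_mul hr.le]
    apply ENNReal.ofReal_le_ofReal
    have e : r * (rear γ h t * (g t / r) * w t) = rear γ h t * g t * w t := by field_simp
    rw [e]
    have := HN_le_rear γ h N htJ.2
    have := hg0 t
    have := hwJ t htJ
    gcongr
  have hcpos : ENNReal.ofReal c ≠ 0 := by simpa using hc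
  have hcK : ∀ a : ℝ≥0∞, a ≠ 0 → a ≠ ⊤ → K ≤ a * orl γ φ w h → Q + R < a := by
    intro a ha0 hat h1
    by_contra hcon
    push Not at hcon
    have h2 : ENNReal.ofReal c * a ≤ a * orl γ φ w h := by
      calc ENNReal.ofReal c * a ≤ ENNReal.ofReal c * (Q + R) := by gcongr
        _ = K := hKeq.symm
        _ ≤ _ := h1
    rw [mul_comm, ENNReal.mul_le_mul_iff_right ha0 hat] at h2
    exact absurd ho (not_lt.2 h2)
  rcases le_or_gt R 1 with hR1 | hR1
  · have h1 := hbound 1 one_pos (by rw [hrhog 1 one_pos]; simpa using hR1)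
    have h2 := hcK 1 one_ne_zero ENNReal.one_ne_top (by simpa using h1)
    exact le_self_add.trans h2.le
  · exfalso
    have hr1 : 1 < R.toReal := by
      rw [← ENNReal.toReal_one]
      exact (ENNReal.toReal_lt_toReal ENNReal.one_ne_top hRfin.ne).2 hR1
    have hr0 : 0 < R.toReal := by linarith
    have hRR : ENNReal.ofReal R.toReal = R := ENNReal.ofReal_toReal hRfin.ne
    have h1 : rho γ (conj φ) w (fun t => g t / R.toReal) ≤ 1 := by
      rw [hrhog _ hr0]
      have : ∫⁻ t in JJ γ, ENNReal.ofReal (conj φ (g t / R.toReal) * w t) ≤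
          ∫⁻ t in JJ γ, ENNReal.ofReal (R.toReal⁻¹) * ENNReal.ofReal (conj φ (g t) * w t) := by
        apply setLIntegral_mono' (meas_JJ γ)
        intro t ht
        rw [← ENNReal.ofReal_mul (by positivity)]
        apply ENNReal.ofReal_le_ofReal
        calc conj φ (g t / R.toReal) * w t ≤ (conj φ (g t) / R.toReal) * w t :=
              mul_le_mul_of_nonneg_right (conj_div hφ hr1.le _) (hwJ t ht)
          _ = _ := by ring
      refine this.trans ?_
      rw [lintegral_const_mul' _ _ ENNReal.ofReal_ne_top, ← hR, ENNReal.ofReal_inv_of_pos hr0, hRR]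
      exact ENNReal.inv_mul_le_one R
    have h2 := hbound _ hr0 h1
    rw [hRR] at h2
    have h3 := hcK R (by positivity) hRfin.ne h2
    exact absurd h3 (not_lt.2 le_add_self)

lemma rho_of_orl {γ : ℝ≥0∞} {h φ w : ℝ → ℝ} (hw : IsWeight γ w) (hφ : IsN φ)
    (hh : Measurable h) {c : ℝ} (hc : 0 < c) (ho : orl γ φ w h < ENNReal.ofReal c) :
    rho γ φ w (fun t => h t / c) ≤ 1 := by
  rw [rho_div hh φ w hc]
  have hm : ∀ N : ℕ, AEMeasurable (fun t => ENNReal.ofReal (φ (HN γ h N t / c) * w t))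
      (volume.restrict (JJ γ)) := by
    intro N
    apply Measurable.aemeasurable
    refine (Measurable.mul ?_ hw.1).ennreal_ofReal
    apply Antitone.measurable
    intro a b hab
    apply phi_mono hφ.1 (div_nonneg (HN_nonneg _ _ _ _) hc.le)
      (div_nonneg (HN_nonneg _ _ _ _) hc.le)
    have := HN_anti (γ := γ) hh N hab
    gcongr
  have h1 := lintegral_liminf_le' (u := (atTop : Filter ℕ)) hm
  calc ∫⁻ t in JJ γ, ENNReal.ofReal (φ (rear γ h t / c) * w t)
      = ∫⁻ t in JJ γ, liminf (fun N : ℕ => ENNReal.ofReal (φ (HN γ h N t / c) * w t)) atTop := by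
        apply setLIntegral_congr_fun (meas_JJ γ)
        intro t ht
        simp only
        symm
        apply Tendsto.liminf_eq
        apply tendsto_const_nhds.congr'
        filter_upwards [HN_eventually γ h ht.2] with N hN
        rw [hN]
    _ ≤ _ := h1
    _ ≤ liminf (fun N : ℕ => (1:ℝ≥0∞)) atTop :=
        liminf_le_liminf (Eventually.of_forall fun N => trunc_bound hw hφ hh hc ho N)
    _ = 1 := by simp

lemma orl_le {γ : ℝ≥0∞} {h φ w : ℝ → ℝ} (hw : IsWeight γ w) (hφ : IsN φ)
    (hm : Measurable h) {c : ℝ} (hc : 0 < c) :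
    orl γ φ w h ≤ ENNReal.ofReal c * (rho γ φ w (fun t => h t / c) + 1) := by
  unfold orl
  refine iSup₂_le ?_
  rintro g ⟨hg, hg1⟩
  refine le_trans ?_ (mul_le_mul_right (add_le_add_right hg1 _) _)
  rw [rho_div hm φ w hc, rho, lint_JJ, lint_JJ,
    ← lintegral_add_left' (aem_phi hm hw.1 (phi_mono hφ.1) hc),
    ← lintegral_const_mul' _ _ ENNReal.ofReal_ne_top]
  apply setLIntegral_mono' (meas_JJ γ)
  intro t ht
  have hwt := (hw.2.1 t ht.1).le
  have h0 : 0 ≤ rear γ h t / c := div_nonneg (rear_nonneg _ _ _) hc.le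
  have p1 := phi_nonneg hφ.1 h0
  have p2 := conj_nonneg hφ (rear γ g t)
  rw [← ENNReal.ofReal_add (by positivity) (by positivity), ← ENNReal.ofReal_mul hc.le, ← add_mul]
  apply ENNReal.ofReal_le_ofReal
  have hy := young hφ h0 (rear γ g t)
  calc rear γ h t * rear γ g t * w t = c * ((rear γ h t / c * rear γ g t) * w t) := by field_simp
    _ ≤ _ := by gcongr

/-- for `f ∈ Λ_{φ,w}` and `f_n = f·χ_{{1/n ≤ |f| ≤ n}}`,
`lim ‖f - f_n‖ = lim ‖f - f_n‖⁰ = θ(f)`. -/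
theorem statement4 (γ : ℝ≥0∞) (hγ : 0 < γ) (w : ℝ → ℝ) (hw : IsWeight γ w)
    (φ : ℝ → ℝ) (hφ : IsN φ) (f : ℝ → ℝ) (hf : MemL γ φ w f) :
    Tendsto (fun n : ℕ =>
        lux γ φ w (fun t => f t - ({s : ℝ | 1 / (n:ℝ) ≤ |f s| ∧ |f s| ≤ (n:ℝ)}.indicator f) t))
      atTop (𝓝 (theta γ φ w f)) ∧
    Tendsto (fun n : ℕ =>
        orl γ φ w (fun t => f t - ({s : ℝ | 1 / (n:ℝ) ≤ |f s| ∧ |f s| ≤ (n:ℝ)}.indicator f) t))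
      atTop (𝓝 (ENNReal.ofReal (theta γ φ w f))) := by
  obtain ⟨hfm, l0, hl0, hl0r⟩ := hf
  have hrmono : ∀ a b : ℝ, 0 < a → a ≤ b → rho γ φ w (fun t => f t / a) < ⊤ →
      rho γ φ w (fun t => f t / b) < ⊤ := by
    intro a b ha hab h
    have hb : 0 < b := ha.trans_le hab
    rw [rho_div hfm φ w hb]
    rw [rho_div hfm φ w ha] at h
    refine lt_of_le_of_lt (setLIntegral_mono' (meas_JJ γ) ?_) h
    intro t ht
    apply ENNReal.ofReal_le_ofReal
    apply mul_le_mul_of_nonneg_right _ (hw.2.1 t ht.1).le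
    apply phi_mono hφ.1 (div_nonneg (rear_nonneg _ _ _) hb.le)
      (div_nonneg (rear_nonneg _ _ _) ha.le)
    exact div_le_div_of_nonneg_left (rear_nonneg _ _ _) ha hab
  have hS0 : rho γ φ w (fun t => f t / (1 / l0)) < ⊤ := by
    have : (fun t => f t / (1 / l0)) = fun t => l0 * f t := by
      funext t; field_simp
    rw [this]; exact hl0r
  have hl0' : 0 < 1 / l0 := by positivity
  have hne : {l : ℝ | 0 < l ∧ rho γ φ w (fun t => f t / l) < ⊤}.Nonempty := ⟨_, hl0', hS0⟩
  have hbd : BddBelow {l : ℝ | 0 < l ∧ rho γ φ w (fun t => f t / l) < ⊤} :=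
    ⟨0, fun _ h => h.1.le⟩
  have hth0 : 0 ≤ theta γ φ w f := Real.sInf_nonneg (fun _ h => h.1.le)
  have hA : ∀ c, theta γ φ w f < c → 0 < c ∧ rho γ φ w (fun t => f t / c) < ⊤ := by
    intro c hc
    obtain ⟨l, hl, hlc⟩ := exists_lt_of_csInf_lt hne hc
    exact ⟨hth0.trans_lt hc, hrmono l c hl.1 hlc.le hl.2⟩
  have hlow : ∀ n : ℕ, 1 ≤ n → ∀ c, 0 < c → rho γ φ w (fun t => hh f n t / c) < ⊤ →
      theta γ φ w f ≤ c := by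
    intro n hn c hc h
    refine csInf_le hbd ⟨hc, ?_⟩
    by_cases hg : Good γ f
    · exact rho_fin_of_hh hw hφ hfm hg hl0' hS0 hn hc h
    · rw [rho_div hfm φ w hc]
      simp [rear_bad hg, hφ.1.2.1]
  have hup : ∀ c, theta γ φ w f < c →
      Tendsto (fun n => rho γ φ w (fun t => hh f n t / c)) atTop (𝓝 0) := fun c hc =>
    rho_hh_tendsto hw hφ hfm (hA c hc).1 (hA c hc).2
  have hone : ∀ c, theta γ φ w f < c →
      ∀ᶠ n in atTop, rho γ φ w (fun t => hh f n t / c) ≤ 1 := fun c hc =>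
    (hup c hc).eventually_le_const (by simp)
  constructor
  · change Tendsto (fun n : ℕ => lux γ φ w (hh f n)) atTop (𝓝 (theta γ φ w f))
    rw [tendsto_order]
    constructor
    · intro a ha
      filter_upwards [hone (theta γ φ w f + 1) (by linarith), eventually_ge_atTop 1] with n h1 h2
      refine ha.trans_le ?_
      unfold lux
      refine le_csInf ⟨theta γ φ w f + 1, by linarith, h1⟩ ?_
      rintro ε ⟨h3, h4⟩
      exact hlow n h2 ε h3 (h4.trans_lt ENNReal.one_lt_top)
    · intro a ha
      obtain ⟨c, hc1, hc2⟩ := exists_between ha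
      filter_upwards [hone c hc1] with n h1
      refine lt_of_le_of_lt ?_ hc2
      exact csInf_le ⟨0, fun _ h => h.1.le⟩ ⟨(hA c hc1).1, h1⟩
  · change Tendsto (fun n : ℕ => orl γ φ w (hh f n)) atTop (𝓝 (ENNReal.ofReal (theta γ φ w f)))
    rw [tendsto_order]
    constructor
    · intro a ha
      filter_upwards [eventually_ge_atTop 1] with n h1
      refine ha.trans_le ?_
      by_contra hcon
      push Not at hcon
      obtain ⟨c, hc0, hc1, hc2⟩ := ENNReal.lt_iff_exists_real_btwn.1 hcon
      have hcpos : 0 < c := by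
        by_contra h
        rw [ENNReal.ofReal_of_nonpos (not_lt.1 h)] at hc1
        simp at hc1
      have h2 := rho_of_orl hw hφ (hh_meas hfm n) hcpos hc1
      have h3 := hlow n h1 c hcpos (h2.trans_lt ENNReal.one_lt_top)
      exact absurd hc2 (not_lt.2 (ENNReal.ofReal_le_ofReal h3))
    · intro a ha
      obtain ⟨c, hc0, hc1, hc2⟩ := ENNReal.lt_iff_exists_real_btwn.1 ha
      have hc : theta γ φ w f < c := by
        by_contra h
        exact absurd hc1 (not_lt.2 (ENNReal.ofReal_le_ofReal (not_lt.1 h)))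
      have hcp := (hA c hc).1
      have ht : Tendsto (fun n => ENNReal.ofReal c * (rho γ φ w (fun t => hh f n t / c) + 1))
          atTop (𝓝 (ENNReal.ofReal c * (0 + 1))) :=
        ENNReal.Tendsto.const_mul ((hup c hc).add_const 1) (Or.inr ENNReal.ofReal_ne_top)
      rw [zero_add, mul_one] at ht
      filter_upwards [ht.eventually_lt_const hc2] with n hn
      exact (orl_le hw hφ (hh_meas hfm n) hcp).trans_lt hn

end OL
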